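/- arXiv:1905.05368 — 4 statements merged into one kernel-verified Lean document; each statement's English description precedes it below -/
import Mathlib

section
/- The CU's utility at the Nash-bargaining point, R ↦ (1 − α*(R))·R − R_m, is a strictly increasing function of the relay rate R on (0, ∞). [Paper's claim after Eq. (7): U^C_{mn}(α*_{mn}(R^C_{mn})) is an increasing function of R^C_{mn}, so a CU prefers the D2D pair offering the higher relay rate.] -/
/-- The Nash-bargaining time allocation `α*(R) = max(α_L, min((R − R_m)/(2R), α_U))`
(Eq. (7) of the paper). -/
noncomputable def alphaStar (Rm αL αU R : ℝ) : ℝ :=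
  max αL (min ((R - Rm) / (2 * R)) αU)

/-- The share of the relay rate kept by the CU at the Nash-bargaining point, as a lattice
expression in functions that are affine in `R`. -/
theorem one_sub_alphaStar_mul (Rm αL αU : ℝ) {R : ℝ} (hR : 0 < R) :
    (1 - alphaStar Rm αL αU R) * R =
      min ((1 - αL) * R) (max ((R + Rm) / 2) ((1 - αU) * R)) := by
  have h : R - (R - Rm) / (2 * R) * R = (R + Rm) / 2 := by
    field_simp
    ring
  rw [alphaStar, sub_mul, one_mul, max_mul_of_nonneg _ _ hR.le, min_mul_of_nonneg _ _ hR.le,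
    ← min_sub_sub_left, ← max_sub_sub_left, h, sub_mul, sub_mul, one_mul]

/-- The CU's utility at the Nash-bargaining point, `R ↦ (1 − α*(R))·R − R_m`, is a strictly
increasing function of the relay rate `R` on `(0, ∞)`. -/
theorem cu_utility_strictMonoOn
    (Rm αL αU RD : ℝ)
    (hRm : 0 ≤ Rm) (hαL : 0 < αL) (hαLU : αL ≤ αU) (hαU : αU < 1)
    (hRD : 0 < RD) :
    StrictMonoOn (fun R => (1 - alphaStar Rm αL αU R) * R - Rm) (Set.Ioi (0 : ℝ)) := by
  intro x hx y hy hxy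
  have hx' : 0 < x := hx
  have hy' : 0 < y := hy
  simp only [one_sub_alphaStar_mul Rm αL αU hx', one_sub_alphaStar_mul Rm αL αU hy']
  refine sub_lt_sub_right (min_lt_min ?_ (max_lt_max ?_ ?_)) Rm
  · exact mul_lt_mul_of_pos_left hxy (by linarith)
  · linarith
  · exact mul_lt_mul_of_pos_left hxy (by linarith)
end

section
/- The bargaining problem (6) is feasible if and only if the CU's utility at the Nash-bargaining point is positive: there exists α ∈ [α_L, α_U] with U^C(α) > 0 and U^D(α) > 0, if and only if (1 − α*(R))·R − R_m > 0. [Paper's claim after Eq. (7): when problem (6) is infeasible, the time allocation α* yields U^C(α*) ≤ 0.] -/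
/-- The bargaining problem (6) is feasible — there is `α ∈ [α_L, α_U]` with `U^C(α) > 0` and
`U^D(α) > 0` — if and only if the CU's utility at the Nash-bargaining point is positive. -/
theorem feasible_iff_cu_utility_pos
    (Rm αL αU RD R : ℝ)
    (hRm : 0 ≤ Rm) (hαL : 0 < αL) (hαLU : αL ≤ αU) (hαU : αU < 1)
    (hRD : 0 < RD) (hR : 0 < R) :
    (∃ α ∈ Set.Icc αL αU, 0 < (1 - α) * R - Rm ∧ 0 < α * RD) ↔
      0 < (1 - alphaStar Rm αL αU R) * R - Rm := by
  have h_half : (R - Rm) / (2 * R) * R = (R - Rm) / 2 := by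
    field_simp
  constructor
  · rintro ⟨α, ⟨hα, -⟩, h_pos, -⟩
    have h_low : 0 < (1 - αL) * R - Rm := by nlinarith
    have h_gap : 0 < R - Rm := by nlinarith [mul_pos hαL hR]
    unfold alphaStar
    rcases max_choice αL (min ((R - Rm) / (2 * R)) αU) with h | h <;> rw [h]
    · exact h_low
    · have h_le := mul_le_mul_of_nonneg_right
        (min_le_left ((R - Rm) / (2 * R)) αU) hR.le
      linarith
  · intro h
    have h_lower : αL ≤ alphaStar Rm αL αU R := le_max_left _ _
    exact ⟨_, ⟨h_lower, max_le hαLU (min_le_right _ _)⟩, h, mul_pos (hαL.trans_le h_lower) hRD⟩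
end

section
/- (Theorem 1, forward direction.) If the action profile b : M → Option N is a pure Nash equilibrium of the game G, then the induced matching μ_b is a stable matching. -/
open scoped Classical

variable {M N : Type*} [DecidableEq M]

/-- `chosen s b n m` : under profile `b`, CU `m` proposes to D2D pair `n` and is the
(unique, since `s · n` is injective) maximizer of `s · n` among the CUs proposing to `n`;
i.e. `Ch_n b = m`. -/
def chosen (s : M → N → ℝ) (b : M → Option N) (n : N) (m : M) : Prop :=
  b m = some n ∧ ∀ m', b m' = some n → s m' n ≤ s m n

/-- CU `m`'s payoff `π_m b` in the game `G` (Eq. (8)): `u m n − θ` if its proposal to `n`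
is accepted, `−θ` if it is rejected, and `0` if it refuses to cooperate. -/
noncomputable def payoff (u s : M → N → ℝ) (θ : ℝ) (b : M → Option N) (m : M) : ℝ :=
  match b m with
  | none => 0
  | some n => if chosen s b n m then u m n - θ else -θ

/-- A pure Nash equilibrium of `G`: no CU has a profitable unilateral deviation. -/
def isPNE (u s : M → N → ℝ) (θ : ℝ) (b : M → Option N) : Prop :=
  ∀ m (a : Option N), payoff u s θ (Function.update b m a) m ≤ payoff u s θ b m

/-- The matching `μ_b` induced by an action profile `b`:
`μ_b m = some n` iff `b m = some n` and `Ch_n b = m`. -/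
noncomputable def inducedMatching (s : M → N → ℝ) (b : M → Option N) (m : M) : Option N :=
  match b m with
  | none => none
  | some n => if chosen s b n m then some n else none

/-- `μ` is a matching: no two CUs are matched with the same D2D pair. -/
def isMatching (μ : M → Option N) : Prop :=
  ∀ m m' n, μ m = some n → μ m' = some n → m = m'

/-- Individual rationality: every matched CU gets positive utility. -/
def indivRational (u : M → N → ℝ) (μ : M → Option N) : Prop :=
  ∀ m n, μ m = some n → 0 < u m n

/-- `(m, n)` is a blocking pair for `μ`: they are not matched together, CU `m` strictly
prefers `n` to its current situation, and D2D pair `n` strictly prefers `m` to any CU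
currently matched with it. -/
def blocks (u s : M → N → ℝ) (μ : M → Option N) (m : M) (n : N) : Prop :=
  μ m ≠ some n ∧
  (∀ n', μ m = some n' → u m n' < u m n) ∧
  (μ m = none → 0 < u m n) ∧
  (∀ m', μ m' = some n → s m' n < s m n)

/-- `μ` is a stable matching: a matching that is individually rational and admits no
blocking pair. -/
def isStable (u s : M → N → ℝ) (μ : M → Option N) : Prop :=
  isMatching μ ∧ indivRational u μ ∧ ∀ m n, ¬ blocks u s μ m n

theorem payoff_of_eq_none {M N : Type*} {u s : M → N → ℝ} {θ : ℝ} {b : M → Option N} {m : M}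
    (h : b m = none) : payoff u s θ b m = 0 := by
  simp [payoff, h]

theorem payoff_of_chosen {M N : Type*} {u s : M → N → ℝ} {θ : ℝ} {b : M → Option N}
    {m : M} {n : N}
    (h : chosen s b n m) : payoff u s θ b m = u m n - θ := by
  simp [payoff, h.1, h]

theorem payoff_of_not_chosen {M N : Type*} {u s : M → N → ℝ} {θ : ℝ} {b : M → Option N}
    {m : M} {n : N}
    (h : b m = some n) (hc : ¬ chosen s b n m) : payoff u s θ b m = -θ := by
  simp [payoff, h, hc]

theorem isPNE.payoff_nonneg {u s : M → N → ℝ} {θ : ℝ} {b : M → Option N}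
    (hb : isPNE u s θ b) (m : M) : 0 ≤ payoff u s θ b m := by
  have h := hb m none
  rwa [payoff_of_eq_none (Function.update_self m none b)] at h

/-- At an equilibrium every proposal is accepted. -/
theorem isPNE.chosen_of_eq_some {u s : M → N → ℝ} {θ : ℝ} {b : M → Option N}
    (hb : isPNE u s θ b) (hθ : 0 < θ) {m : M} {n : N} (h : b m = some n) :
    chosen s b n m := by
  by_contra hc
  have := hb.payoff_nonneg m
  rw [payoff_of_not_chosen h hc] at this
  linarith

theorem isPNE.inducedMatching_eq {u s : M → N → ℝ} {θ : ℝ} {b : M → Option N}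
    (hb : isPNE u s θ b) (hθ : 0 < θ) : inducedMatching s b = b := by
  funext m
  cases h : b m with
  | none => simp [inducedMatching, h]
  | some n => simp [inducedMatching, h, hb.chosen_of_eq_some hθ h]

/-- A CU that `n` ranks above all its current proposers is chosen after deviating to `n`. -/
theorem chosen_update {s : M → N → ℝ} {b : M → Option N} {m : M} {n : N}
    (h : ∀ m', b m' = some n → s m' n < s m n) :
    chosen s (Function.update b m (some n)) n m := by
  refine ⟨Function.update_self m (some n) b, fun m' hm' => ?_⟩
  by_cases hmm : m' = m
  · rw [hmm]
  · rw [Function.update_of_ne hmm] at hm'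
    exact (h m' hm').le

/-- Theorem 1 (forward direction): if the action profile `b` is a pure Nash equilibrium of
the game `G`, then the induced matching `μ_b` is a stable matching. -/
theorem pne_induces_stable
    {M N : Type*} [Fintype M] [Nonempty M] [DecidableEq M] [Fintype N] [Nonempty N]
    (u s : M → N → ℝ) (θ : ℝ)
    (hs : ∀ n, Function.Injective fun m => s m n)
    (hθ : 0 < θ) (hθu : ∀ m n, 0 < u m n → θ < u m n)
    (b : M → Option N) (hb : isPNE u s θ b) :
    isStable u s (inducedMatching s b) := by
  rw [hb.inducedMatching_eq hθ]
  refine ⟨fun m m' n h h' => ?_, fun m n h => ?_, ?_⟩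
  · exact hs n (le_antisymm ((hb.chosen_of_eq_some hθ h').2 m h)
      ((hb.chosen_of_eq_some hθ h).2 m' h'))
  · have := hb.payoff_nonneg m
    rw [payoff_of_chosen (hb.chosen_of_eq_some hθ h)] at this
    linarith
  · rintro m n ⟨-, hpref, hnone, hrank⟩
    have hdev := hb m (some n)
    rw [payoff_of_chosen (chosen_update hrank)] at hdev
    cases h : b m with
    | none =>
      rw [payoff_of_eq_none h] at hdev
      linarith [hθu m n (hnone h)]
    | some n' =>
      rw [payoff_of_chosen (hb.chosen_of_eq_some hθ h)] at hdev
      linarith [hpref n' h]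
end

section
/- The game G possesses a pure Nash equilibrium. [Combines the guaranteed existence of a stable matching for the two-sided market with strict preferences with the backward direction of the paper's Theorem 1.] -/
open scoped Classical

variable {M N : Type*} [DecidableEq M]

/-- Among the acceptable D2D pairs outside a set `S` of rejections, a CU has a favourite one
(or none if there is no such pair). -/
lemma exists_best_outside {N : Type*} [Finite N] (v : N → ℝ) (S : Set N) :
    ∃ o : Option N, (∀ n, o = some n → n ∉ S ∧ 0 < v n) ∧
      ∀ n, n ∉ S → 0 < v n → ∃ k, o = some k ∧ v n ≤ v k := by
  rcases Set.eq_empty_or_nonempty {n | n ∉ S ∧ 0 < v n} with h | h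
  · refine ⟨none, by simp, fun n hn hv => ?_⟩
    have : n ∈ {n | n ∉ S ∧ 0 < v n} := ⟨hn, hv⟩
    simp [h] at this
  · obtain ⟨k, hk, hmax⟩ := Set.exists_max_image _ v (Set.toFinite _) h
    refine ⟨some k, ?_, fun n hn hv => ⟨k, rfl, hmax n ⟨hn, hv⟩⟩⟩
    rintro n ⟨⟩
    exact hk

/-- The two-sided market with strict preferences of the D2D pairs has a stable matching: let every
CU propose to its favourite pair outside a maximal family `R` of justified rejections. -/
lemma exists_isStable {M N : Type*} [Finite M] [Finite N] (u s : M → N → ℝ)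
    (hs : ∀ n, Function.Injective fun m => s m n) :
    ∃ μ : M → Option N, isStable u s μ := by
  choose f hf hbest using fun m => exists_best_outside (u m)
  let justified : Set (M → Set N) :=
    {R | ∀ m n, n ∈ R m → ∃ m', f m' (R m') = some n ∧ s m n < s m' n}
  obtain ⟨R, hR⟩ : ∃ R, Maximal (· ∈ justified) R :=
    (Set.toFinite justified).exists_maximal ⟨fun _ => ∅, by simp [justified]⟩
  have not_lt (m m' n) (hm : f m (R m) = some n) (hm' : f m' (R m') = some n) :
      ¬ s m n < s m' n := by
    intro hlt
    have hne : m' ≠ m := by rintro rfl; exact lt_irrefl _ hlt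
    have hle : R ≤ Function.update R m (insert n (R m)) := by
      rw [le_update_iff]
      exact ⟨Set.subset_insert _ _, fun _ _ => le_rfl⟩
    have hmem : Function.update R m (insert n (R m)) ∈ justified := by
      have transfer (a k) (h : k ∈ R a ∨ a = m ∧ k = n) : ∃ m'',
          f m'' (Function.update R m (insert n (R m)) m'') = some k ∧ s a k < s m'' k := by
        rcases h with h | ⟨rfl, rfl⟩
        · obtain ⟨c, hc, hlt'⟩ := hR.prop a k h
          by_cases hcm : c = m
          · subst hcm
            obtain rfl : n = k := Option.some.inj (hm.symm.trans hc)
            exact ⟨m', by simpa [hne] using hm', hlt'.trans hlt⟩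
          · exact ⟨c, by simpa [hcm] using hc, hlt'⟩
        · exact ⟨m', by simpa [hne] using hm', hlt⟩
      intro a k hk
      apply transfer
      by_cases ha : a = m
      · subst ha
        simpa [or_comm] using hk
      · simpa [ha] using hk
    have hn : n ∈ Function.update R m (insert n (R m)) m := by simp
    exact (hf m _ n hm).1 (hR.le_of_ge hmem hle m hn)
  refine ⟨fun m => f m (R m), ?_, fun m n h => (hf m _ n h).2, ?_⟩
  · intro m m' n hm hm'
    exact hs n (le_antisymm (le_of_not_gt (not_lt m' m n hm' hm)) (le_of_not_gt (not_lt m m' n hm hm')))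
  · rintro m n ⟨-, hsome, hnone, hpref⟩
    have hpos : 0 < u m n := by
      cases h : f m (R m) with
      | none => exact hnone h
      | some k => exact (hf m _ k h).2.trans (hsome k h)
    by_cases hn : n ∈ R m
    · obtain ⟨m', hm', hlt⟩ := hR.prop m n hn
      exact lt_asymm hlt (hpref m' hm')
    · obtain ⟨k, hk, hle⟩ := hbest m _ n hn hpos
      exact (hsome k hk).not_ge hle

/-- A stable matching, played as an action profile, is a pure Nash equilibrium. -/
lemma isStable.isPNE {M N : Type*} [DecidableEq M] {u s : M → N → ℝ} {θ : ℝ}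
    {μ : M → Option N} (hμ : isStable u s μ)
    (hs : ∀ n, Function.Injective fun m => s m n)
    (hθ : 0 < θ) (hθu : ∀ m n, 0 < u m n → θ < u m n) : isPNE u s θ μ := by
  obtain ⟨hmatch, hrat, hstable⟩ := hμ
  intro m a
  have payoff_some (n) (h : μ m = some n) : payoff u s θ μ m = u m n - θ := by
    have hc : chosen s μ n m := ⟨h, fun m' hm' => by rw [hmatch m' m n hm' h]⟩
    simp [payoff, h, hc]
  have payoff_none (h : μ m = none) : payoff u s θ μ m = 0 := by simp [payoff, h]
  have payoff_nonneg : 0 ≤ payoff u s θ μ m := by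
    cases h : μ m with
    | none => exact (payoff_none h).ge
    | some n =>
      rw [payoff_some n h]
      linarith [hθu m n (hrat m n h)]
  cases a with
  | none => simpa [payoff] using payoff_nonneg
  | some n =>
    by_cases hc : chosen s (Function.update μ m (some n)) n m
    · have hdev : payoff u s θ (Function.update μ m (some n)) m = u m n - θ := by
        simp [payoff, hc]
      rw [hdev]
      by_contra! hlt
      refine hstable m n ⟨fun h => ?_, fun k hk => ?_, fun h => ?_, fun m' hm' => ?_⟩
      · exact hlt.ne (payoff_some n h)
      · linarith [payoff_some k hk]
      · linarith
      · have hne : m' ≠ m := by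
          rintro rfl
          exact hlt.ne (payoff_some n hm')
        exact (hc.2 m' (by simpa [hne] using hm')).lt_of_ne fun h => hne (hs n h)
    · have hdev : payoff u s θ (Function.update μ m (some n)) m = -θ := by
        simp [payoff, hc]
      linarith

/-- The game `G` possesses a pure Nash equilibrium (existence of a stable matching for the
two-sided market with strict preferences, combined with Theorem 1). -/
theorem exists_pne
    {M N : Type*} [Fintype M] [Nonempty M] [DecidableEq M] [Fintype N] [Nonempty N]
    (u s : M → N → ℝ) (θ : ℝ)
    (hs : ∀ n, Function.Injective fun m => s m n)
    (hθ : 0 < θ) (hθu : ∀ m n, 0 < u m n → θ < u m n) :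
    ∃ b : M → Option N, isPNE u s θ b := by
  obtain ⟨μ, hμ⟩ := exists_isStable u s hs
  exact ⟨μ, hμ.isPNE hs hθ hθu⟩
end
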